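/- arXiv:0812.4003 — 2 statements merged into one kernel-verified Lean document; each statement's English description precedes it below -/
import Mathlib

section
/- Let q : ℝ×ℝ → ℝ be a classical solution of the KdV equation q_t = -q_xxx + 6 q q_x (all partial derivatives appearing in the equation exist and are continuous) such that q(·,t) and q_x(·,t) are bounded on ℝ for each t. Then for every λ ∈ ℂ and every pair a₀, b₀ ∈ ℂ, the system of differential equations L_q u = λ u and u_t = P_q u has a unique solution u : ℝ×ℝ → ℂ (twice continuously differentiable in x, once in t, with the required mixed partials continuous) satisfying the initial conditions u(0,0) = a₀ and u_x(0,0) = b₀. Moreover, if a₀ = a₀(λ) and b₀ = b₀(λ) depend continuously on λ, then so does u(λ,x,t). -/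
/-- Partial derivative with respect to the first (spatial) variable. -/
noncomputable def pdx {E : Type*} [NormedAddCommGroup E] [NormedSpace ℝ E]
    (u : ℝ → ℝ → E) : ℝ → ℝ → E :=
  fun x t => deriv (fun x' => u x' t) x

/-- Partial derivative with respect to the second (time) variable. -/
noncomputable def pdt {E : Type*} [NormedAddCommGroup E] [NormedSpace ℝ E]
    (u : ℝ → ℝ → E) : ℝ → ℝ → E :=
  fun x t => deriv (fun t' => u x t') t

/-- The Schrödinger (Lax) operator `L_q u = -u_xx + q u`. -/
noncomputable def Lop (q : ℝ → ℝ → ℝ) (u : ℝ → ℝ → ℂ) : ℝ → ℝ → ℂ :=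
  fun x t => -(pdx (pdx u) x t) + (q x t : ℂ) * u x t

/-- The second Lax operator `P_q u = -4 u_xxx + 6 q u_x + 3 q_x u`. -/
noncomputable def Pop (q : ℝ → ℝ → ℝ) (u : ℝ → ℝ → ℂ) : ℝ → ℝ → ℂ :=
  fun x t => -4 * pdx (pdx (pdx u)) x t + 6 * (q x t : ℂ) * pdx u x t
    + 3 * ((pdx q x t : ℝ) : ℂ) * u x t

/-- The KdV equation `q_t = -q_xxx + 6 q q_x`. -/
def KdV (q : ℝ → ℝ → ℝ) : Prop :=
  ∀ x t, pdt q x t = -(pdx (pdx (pdx q)) x t) + 6 * q x t * pdx q x t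


/-- `u` is a solution of the system `L_q u = λ u`, `u_t = P_q u`, twice continuously
differentiable in `x`, once in `t`, with the required (mixed) partial derivatives
continuous. -/
def SmoothSol (q : ℝ → ℝ → ℝ) (lam : ℂ) (u : ℝ → ℝ → ℂ) : Prop :=
  (∀ t, ContDiff ℝ 2 fun x => u x t) ∧
  (∀ x, ContDiff ℝ 1 fun t => u x t) ∧
  Continuous (fun p : ℝ × ℝ => u p.1 p.2) ∧
  Continuous (fun p : ℝ × ℝ => pdx u p.1 p.2) ∧
  Continuous (fun p : ℝ × ℝ => pdx (pdx u) p.1 p.2) ∧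
  Continuous (fun p : ℝ × ℝ => pdt u p.1 p.2) ∧
  (∀ x t, Lop q u x t = lam * u x t) ∧
  (∀ x t, pdt u x t = Pop q u x t)

open Set Filter Topology MeasureTheory

section LinearODE

variable {P : Type*} [TopologicalSpace P] {F : Type*} [NormedAddCommGroup F] [NormedSpace ℝ F]

/-- The terms of the Picard series of the linear equation `y' = A x y`, `y 0 = w`. -/
noncomputable def picardTerm (A : ℝ → F →L[ℝ] F) (w : F) : ℕ → ℝ → F
  | 0 => fun _ => w
  | n + 1 => fun x => ∫ y in (0 : ℝ)..x, A y (picardTerm A w n y)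

/-- The solution of `y' = A x y`, `y 0 = w`, given by its Picard series. -/
noncomputable def linearFlow (A : ℝ → F →L[ℝ] F) (w : F) (x : ℝ) : F :=
  ∑' n, picardTerm A w n x

lemma continuous_picardTerm [FirstCountableTopology P] [WeaklyLocallyCompactSpace P]
    {A : P → ℝ → F →L[ℝ] F} {w : P → F}
    (hA : Continuous fun z : P × ℝ => A z.1 z.2) (hw : Continuous w) (n : ℕ) :
    Continuous fun z : P × ℝ => picardTerm (A z.1) (w z.1) n z.2 := by
  induction n with
  | zero => exact hw.comp continuous_fst
  | succ n ih =>
    exact intervalIntegral.continuous_parametric_primitive_of_continuous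
      (f := fun p y => A p y (picardTerm (A p) (w p) n y)) (hA.clm_apply ih)

lemma continuous_picardTerm_apply {A : ℝ → F →L[ℝ] F} (hA : Continuous A) (w : F) (n : ℕ) :
    Continuous (picardTerm A w n) :=
  (continuous_picardTerm (P := Unit) (A := fun _ => A) (w := fun _ => w)
    (hA.comp continuous_snd) continuous_const n).comp (Continuous.prodMk_right ())

lemma norm_picardTerm_le {A : ℝ → F →L[ℝ] F} {w : F} {K M R : ℝ}
    (hA : ∀ x, |x| ≤ R → ‖A x‖ ≤ K) (hw : ‖w‖ ≤ M) (n : ℕ) {x : ℝ} (hx : |x| ≤ R) :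
    ‖picardTerm A w n x‖ ≤ M * (K * |x|) ^ n / n.factorial := by
  induction n generalizing x with
  | zero => simpa [picardTerm] using hw
  | succ n ih =>
    have hK : 0 ≤ K := (norm_nonneg _).trans (hA x hx)
    have hM : 0 ≤ M := (norm_nonneg _).trans hw
    have hbd : ∀ y ∈ uIoc 0 x, ‖A y (picardTerm A w n y)‖ ≤
        M * K ^ (n + 1) / n.factorial * |y - 0| ^ n := by
      intro y hy
      have hy' : |y| ≤ R := by
        have : |y| ≤ |x| := by
          simpa using abs_sub_left_of_mem_uIcc (uIoc_subset_uIcc hy)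
        exact this.trans hx
      calc ‖A y (picardTerm A w n y)‖ ≤ K * (M * (K * |y|) ^ n / n.factorial) :=
            (A y).le_of_opNorm_le_of_le (hA y hy') (ih hy')
        _ = _ := by rw [sub_zero, mul_pow]; ring
    calc ‖picardTerm A w (n + 1) x‖
        ≤ ∫ y in uIoc 0 x, M * K ^ (n + 1) / n.factorial * |y - 0| ^ n := by
          refine intervalIntegral.norm_integral_le_integral_norm_uIoc.trans ?_
          refine integral_mono_of_nonneg (.of_forall fun _ => norm_nonneg _) ?_ ?_
          · exact (Continuous.integrableOn_uIoc (by fun_prop))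
          · exact (ae_restrict_iff' measurableSet_uIoc).2 (.of_forall hbd)
      _ = M * (K * |x|) ^ (n + 1) / (n + 1).factorial := by
          rw [integral_const_mul, integral_pow_abs_sub_uIoc, sub_zero, Nat.factorial_succ, mul_pow]
          push_cast
          field_simp

/-- On compact sets the Picard series is dominated by a summable sequence. -/
lemma exists_summable_picardTerm_bound {A : P → ℝ → F →L[ℝ] F} {w : P → F}
    (hA : Continuous fun z : P × ℝ => A z.1 z.2) (hw : Continuous w) {C : Set P}
    (hC : IsCompact C) (R : ℝ) :
    ∃ b : ℕ → ℝ, Summable b ∧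
      ∀ n, ∀ p ∈ C, ∀ x, |x| ≤ R → ‖picardTerm (A p) (w p) n x‖ ≤ b n := by
  obtain ⟨K, hK⟩ := (hC.prod (isCompact_Icc (a := -R) (b := R))).exists_bound_of_continuousOn
    hA.continuousOn
  obtain ⟨M, hM⟩ := hC.exists_bound_of_continuousOn hw.continuousOn
  refine ⟨fun n => M * ((K * R) ^ n / n.factorial),
    (Real.summable_pow_div_factorial (K * R)).mul_left M, fun n p hp x hx => ?_⟩
  have hA' : ∀ x, |x| ≤ R → ‖A p x‖ ≤ K := fun x hx => hK (p, x) ⟨hp, abs_le.1 hx⟩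
  have hK0 : 0 ≤ K := (norm_nonneg _).trans (hA' x hx)
  have hM0 : 0 ≤ M := (norm_nonneg _).trans (hM p hp)
  refine (norm_picardTerm_le hA' (hM p hp) n hx).trans ?_
  rw [mul_div_assoc]
  change _ ≤ M * ((K * R) ^ n / n.factorial)
  gcongr

lemma linearFlow_zero (A : ℝ → F →L[ℝ] F) (w : F) : linearFlow A w 0 = w := by
  rw [linearFlow, tsum_eq_single 0]
  · rfl
  · rintro (_ | n) hn
    · exact absurd rfl hn
    · simp [picardTerm]

lemma eq_of_hasDerivAt_linear {A : ℝ → F →L[ℝ] F} (hA : Continuous A) {f g : ℝ → F}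
    (hf : ∀ x, HasDerivAt f (A x (f x)) x) (hg : ∀ x, HasDerivAt g (A x (g x)) x)
    (h0 : f 0 = g 0) : f = g := by
  ext x
  obtain ⟨K, hK⟩ := (isCompact_Icc (a := -(|x| + 1)) (b := |x| + 1)).exists_bound_of_continuousOn
    hA.continuousOn
  have hx : x ∈ Ioo (-(|x| + 1)) (|x| + 1) := abs_lt.1 (lt_add_one |x|)
  refine ODE_solution_unique_of_mem_Ioo (v := fun y => A y) (s := fun _ => univ) (K := K.toNNReal)
    (t₀ := 0) (fun y hy => ?_) (by constructor <;> nlinarith [abs_nonneg x])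
    (fun y _ => ⟨hf y, trivial⟩) (fun y _ => ⟨hg y, trivial⟩) h0 hx
  refine ((A y).lipschitz.weaken ?_).lipschitzOnWith
  rw [← NNReal.coe_le_coe]
  exact (hK y (Ioo_subset_Icc_self hy)).trans (Real.le_coe_toNNReal K)

/-- Differentiation under the integral sign for jointly continuous data. -/
lemma hasDerivAt_intervalIntegral_of_continuous {f f' : ℝ → ℝ → F}
    (hf : Continuous fun z : ℝ × ℝ => f z.1 z.2) (hf' : Continuous fun z : ℝ × ℝ => f' z.1 z.2)
    (h : ∀ t y, HasDerivAt (fun t => f t y) (f' t y) t) (a b t : ℝ) :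
    HasDerivAt (fun t => ∫ y in a..b, f t y) (∫ y in a..b, f' t y) t := by
  obtain ⟨C, hC⟩ := ((isCompact_Icc (a := t - 1) (b := t + 1)).prod
    (isCompact_uIcc (a := a) (b := b))).exists_bound_of_continuousOn hf'.continuousOn
  refine (intervalIntegral.hasDerivAt_integral_of_dominated_loc_of_deriv_le
    (s := Icc (t - 1) (t + 1)) (bound := fun _ => C)
    (Icc_mem_nhds (by linarith) (by linarith)) (.of_forall fun s => ?_) ?_ ?_ ?_ ?_ ?_).2
  · exact (hf.comp (Continuous.prodMk_right s)).aestronglyMeasurable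
  · exact (hf.comp (Continuous.prodMk_right t)).intervalIntegrable _ _
  · exact (hf'.comp (Continuous.prodMk_right t)).aestronglyMeasurable
  · exact .of_forall fun y hy s hs => hC (s, y) ⟨hs, uIoc_subset_uIcc hy⟩
  · exact intervalIntegrable_const
  · exact .of_forall fun y _ s _ => h s y

/-- The coefficient of the system satisfied by a solution of `y' = A x y` together with its
derivative with respect to a parameter on which `A` depends with derivative `A'`. -/
noncomputable def variationalCoeff (A A' : ℝ → F →L[ℝ] F) (x : ℝ) : F × F →L[ℝ] F × F :=
  ((A x).comp (.fst ℝ F F)).prod ((A' x).comp (.fst ℝ F F) + (A x).comp (.snd ℝ F F))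

lemma continuous_variationalCoeff {A A' : P → ℝ → F →L[ℝ] F}
    (hA : Continuous fun z : P × ℝ => A z.1 z.2) (hA' : Continuous fun z : P × ℝ => A' z.1 z.2) :
    Continuous fun z : P × ℝ => variationalCoeff (A z.1) (A' z.1) z.2 := by
  have := ((ContinuousLinearMap.prodₗᵢ (𝕜 := ℝ) (E := F × F) (F := F) (G := F) ℝ).continuous).comp
    ((hA.clm_comp (continuous_const (y := ContinuousLinearMap.fst ℝ F F))).prodMk
      ((hA'.clm_comp (continuous_const (y := ContinuousLinearMap.fst ℝ F F))).add
        (hA.clm_comp (continuous_const (y := ContinuousLinearMap.snd ℝ F F)))))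
  exact this

variable [CompleteSpace F]

lemma summable_picardTerm {A : ℝ → F →L[ℝ] F} (hA : Continuous A) (w : F) (x : ℝ) :
    Summable fun n => picardTerm A w n x := by
  obtain ⟨b, hb, h⟩ := exists_summable_picardTerm_bound (P := Unit) (A := fun _ => A)
    (w := fun _ => w) (hA.comp continuous_snd) continuous_const isCompact_univ |x|
  exact .of_norm_bounded hb fun n => h n () trivial x le_rfl

lemma continuous_linearFlow [FirstCountableTopology P] [WeaklyLocallyCompactSpace P]
    {A : P → ℝ → F →L[ℝ] F} {w : P → F}
    (hA : Continuous fun z : P × ℝ => A z.1 z.2) (hw : Continuous w) :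
    Continuous fun z : P × ℝ => linearFlow (A z.1) (w z.1) z.2 := by
  rw [continuous_iff_continuousAt]
  rintro ⟨p, x⟩
  obtain ⟨C, hC, hpC⟩ := exists_compact_mem_nhds p
  obtain ⟨b, hb, h⟩ := exists_summable_picardTerm_bound hA hw hC (|x| + 1)
  have hnhds : C ×ˢ {y : ℝ | |y| ≤ |x| + 1} ∈ 𝓝 (p, x) := by
    refine prod_mem_nhds hpC ?_
    filter_upwards [continuous_abs.continuousAt.eventually_lt continuousAt_const
      (lt_add_one |x|)] with y hy using hy.le
  exact (continuousOn_tsum (fun n => (continuous_picardTerm hA hw n).continuousOn) hb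
    fun n z hz => h n z.1 hz.1 z.2 hz.2).continuousAt hnhds

lemma hasDerivAt_picardTerm_succ {A : ℝ → F →L[ℝ] F} (hA : Continuous A) (w : F) (n : ℕ) (x : ℝ) :
    HasDerivAt (picardTerm A w (n + 1)) (A x (picardTerm A w n x)) x :=
  (hA.clm_apply (continuous_picardTerm_apply hA w n)).integral_hasStrictDerivAt 0 x |>.hasDerivAt

lemma hasDerivAt_linearFlow {A : ℝ → F →L[ℝ] F} (hA : Continuous A) (w : F) (x : ℝ) :
    HasDerivAt (linearFlow A w) (A x (linearFlow A w x)) x := by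
  have hflow : linearFlow A w = fun x => w + ∑' n, picardTerm A w (n + 1) x :=
    funext fun x => (summable_picardTerm hA w x).tsum_eq_zero_add
  obtain ⟨b, hb, h⟩ := exists_summable_picardTerm_bound (P := Unit) (A := fun _ => A)
    (w := fun _ => w) (hA.comp continuous_snd) continuous_const isCompact_univ (|x| + 1)
  obtain ⟨K, hK⟩ := (isCompact_Icc (a := -(|x| + 1)) (b := |x| + 1)).exists_bound_of_continuousOn
    hA.continuousOn
  have hder := hasDerivAt_tsum_of_isPreconnected (hb.mul_left K) isOpen_Ioo
    (isPreconnected_Ioo (a := -(|x| + 1)) (b := |x| + 1))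
    (g := fun n => picardTerm A w (n + 1)) (g' := fun n y => A y (picardTerm A w n y)) (y₀ := x)
    (y := x) (fun n y _ => hasDerivAt_picardTerm_succ hA w n y)
    (fun n y hy => (A y).le_of_opNorm_le_of_le (hK y (Ioo_subset_Icc_self hy))
      (h n () trivial y (abs_lt.2 hy).le)) (abs_lt.1 (lt_add_one |x|))
    ((summable_nat_add_iff 1).2 (summable_picardTerm hA w x)) (abs_lt.1 (lt_add_one |x|))
  rw [← (A x).map_tsum (summable_picardTerm hA w x)] at hder
  rw [show A x (linearFlow A w x) = A x (∑' n, picardTerm A w n x) from rfl, hflow]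
  exact hder.const_add w

/-- The solution of a linear equation is differentiable in a parameter. -/
lemma hasDerivAt_fst_linearFlow_variationalCoeff {A A' : ℝ → ℝ → F →L[ℝ] F} {w w' : ℝ → F}
    (hA : Continuous fun z : ℝ × ℝ => A z.1 z.2) (hA' : Continuous fun z : ℝ × ℝ => A' z.1 z.2)
    (hAA' : ∀ t x, HasDerivAt (fun t => A t x) (A' t x) t) (hw' : Continuous w')
    (hww' : ∀ t, HasDerivAt w (w' t) t) (t x : ℝ) :
    HasDerivAt (fun t => (linearFlow (variationalCoeff (A t) (A' t)) (w t, w' t) x).1)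
      (linearFlow (variationalCoeff (A t) (A' t)) (w t, w' t) x).2 t := by
  set D : ℕ → ℝ → ℝ → F × F :=
    fun n t x => picardTerm (variationalCoeff (A t) (A' t)) (w t, w' t) n x with hD
  have hcoeff := continuous_variationalCoeff hA hA'
  have hw : Continuous w := continuous_iff_continuousAt.2 fun t => (hww' t).continuousAt
  have hDc : ∀ n, Continuous fun z : ℝ × ℝ => D n z.1 z.2 :=
    continuous_picardTerm (A := fun t => variationalCoeff (A t) (A' t)) (w := fun t => (w t, w' t))
      hcoeff (hw.prodMk hw')
  have hcoeff1 (t : ℝ) : Continuous (variationalCoeff (A t) (A' t)) :=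
    hcoeff.comp (Continuous.prodMk_right t)
  have hterm : ∀ n t x, HasDerivAt (fun t => (D n t x).1) (D n t x).2 t := by
    intro n
    induction n with
    | zero => exact fun t _ => hww' t
    | succ n ih =>
      intro t x
      have hint (t : ℝ) : IntervalIntegrable
          (fun y => variationalCoeff (A t) (A' t) y (D n t y)) volume 0 x :=
        ((hcoeff1 t).clm_apply ((hDc n).comp (Continuous.prodMk_right t))).intervalIntegrable _ _
      have h1 (t : ℝ) : (D (n + 1) t x).1 = ∫ y in (0 : ℝ)..x, A t y (D n t y).1 :=
        ((ContinuousLinearMap.fst ℝ F F).intervalIntegral_comp_comm (hint t)).symm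
      have h2 : (D (n + 1) t x).2 = ∫ y in (0 : ℝ)..x, (A' t y (D n t y).1 + A t y (D n t y).2) :=
        ((ContinuousLinearMap.snd ℝ F F).intervalIntegral_comp_comm (hint t)).symm
      simp_rw [h1, h2]
      exact hasDerivAt_intervalIntegral_of_continuous
        (f := fun t y => A t y (D n t y).1)
        (f' := fun t y => A' t y (D n t y).1 + A t y (D n t y).2)
        (hA.clm_apply (hDc n).fst)
        ((hA'.clm_apply (hDc n).fst).add (hA.clm_apply (hDc n).snd))
        (fun t y => (hAA' t y).clm_apply (ih t y)) 0 x t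
  obtain ⟨b, hb, h⟩ := exists_summable_picardTerm_bound
    (A := fun t => variationalCoeff (A t) (A' t)) (w := fun t => (w t, w' t)) hcoeff (hw.prodMk hw')
    (isCompact_Icc (a := t - 1) (b := t + 1)) |x|
  have hsum (t : ℝ) : Summable fun n => D n t x := summable_picardTerm (hcoeff1 t) _ x
  have h1 (t : ℝ) : (linearFlow (variationalCoeff (A t) (A' t)) (w t, w' t) x).1 =
      ∑' n, (D n t x).1 := (ContinuousLinearMap.fst ℝ F F).map_tsum (hsum t)
  have h2 : (linearFlow (variationalCoeff (A t) (A' t)) (w t, w' t) x).2 =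
      ∑' n, (D n t x).2 := (ContinuousLinearMap.snd ℝ F F).map_tsum (hsum t)
  simp_rw [h1, h2]
  have ht : t ∈ Ioo (t - 1) (t + 1) := ⟨by linarith, by linarith⟩
  exact hasDerivAt_tsum_of_isPreconnected hb isOpen_Ioo isPreconnected_Ioo
    (fun n s _ => hterm n s x)
    (fun n s hs => (norm_snd_le _).trans (h n s (Ioo_subset_Icc_self hs) x le_rfl)) ht
    ((ContinuousLinearMap.fst ℝ F F).summable (hsum t)) ht

/-- A linear equation whose coefficient and initial value are continuously differentiable in `t`
has a solution that is continuously differentiable in `t`, and its `t`-derivative solves the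
variational equation. -/
lemma exists_linear_family [FirstCountableTopology P] [WeaklyLocallyCompactSpace P]
    {A A' : P → ℝ → ℝ → F →L[ℝ] F} {w w' : P → ℝ → F}
    (hA : Continuous fun z : (P × ℝ) × ℝ => A z.1.1 z.1.2 z.2)
    (hA' : Continuous fun z : (P × ℝ) × ℝ => A' z.1.1 z.1.2 z.2)
    (hAA' : ∀ p t x, HasDerivAt (fun t => A p t x) (A' p t x) t)
    (hw : Continuous fun z : P × ℝ => w z.1 z.2) (hw' : Continuous fun z : P × ℝ => w' z.1 z.2)
    (hww' : ∀ p t, HasDerivAt (w p) (w' p t) t) :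
    ∃ W Z : P → ℝ → ℝ → F,
      (Continuous fun z : P × ℝ × ℝ => W z.1 z.2.1 z.2.2) ∧
      (∀ p x t, HasDerivAt (fun x => W p x t) (A p t x (W p x t)) x) ∧
      (∀ p x t, HasDerivAt (fun x => Z p x t) (A' p t x (W p x t) + A p t x (Z p x t)) x) ∧
      (∀ p x t, HasDerivAt (fun t => W p x t) (Z p x t) t) ∧
      (∀ p t, W p 0 t = w p t) ∧ ∀ p t, Z p 0 t = w' p t := by
  let C : P × ℝ → ℝ → F × F →L[ℝ] F × F :=
    fun r => variationalCoeff (A r.1 r.2) (A' r.1 r.2)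
  have hC : Continuous fun z : (P × ℝ) × ℝ => C z.1 z.2 :=
    continuous_variationalCoeff (A := fun r : P × ℝ => A r.1 r.2) (A' := fun r => A' r.1 r.2)
      hA hA'
  let Y : P → ℝ → ℝ → F × F := fun p x t => linearFlow (C (p, t)) (w p t, w' p t) x
  have hYc : Continuous fun z : P × ℝ × ℝ => Y z.1 z.2.1 z.2.2 :=
    (continuous_linearFlow (A := C) (w := fun r => (w r.1 r.2, w' r.1 r.2)) hC
      (hw.prodMk hw')).comp
      ((continuous_fst.prodMk continuous_snd.snd).prodMk continuous_snd.fst)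
  have hYx (p : P) (x t : ℝ) : HasDerivAt (fun x => Y p x t) (C (p, t) x (Y p x t)) x :=
    hasDerivAt_linearFlow (hC.comp (Continuous.prodMk_right (p, t))) _ x
  have hY0 (p : P) (t : ℝ) : Y p 0 t = (w p t, w' p t) := linearFlow_zero _ _
  have hslice (p : P) : Continuous fun z : ℝ × ℝ => ((p, z.1), z.2) := by fun_prop
  exact ⟨fun p x t => (Y p x t).1, fun p x t => (Y p x t).2, hYc.fst, fun p x t => (hYx p x t).fst,
    fun p x t => (hYx p x t).snd,
    fun p x t => hasDerivAt_fst_linearFlow_variationalCoeff (A := A p) (A' := A' p)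
      (hA.comp (hslice p)) (hA'.comp (hslice p)) (hAA' p)
      (hw'.comp (Continuous.prodMk_right p)) (hww' p) t x,
    fun p t => congrArg Prod.fst (hY0 p t), fun p t => congrArg Prod.snd (hY0 p t)⟩

end LinearODE

section LaxPair

/-- If `u_x = v` and `u_t = g`, then `v_t = g_x`. -/
lemma hasDerivAt_mixed {F : Type*} [NormedAddCommGroup F] [NormedSpace ℝ F] [CompleteSpace F]
    {u v g h : ℝ → ℝ → F} (hu : ∀ x t, HasDerivAt (fun x => u x t) (v x t) x)
    (hg : ∀ x t, HasDerivAt (fun t => u x t) (g x t) t)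
    (hgc : Continuous fun z : ℝ × ℝ => g z.1 z.2)
    (hgx : ∀ x t, HasDerivAt (fun x => g x t) (h x t) x)
    (hhc : Continuous fun z : ℝ × ℝ => h z.1 z.2) (x t : ℝ) :
    HasDerivAt (fun t => v x t) (h x t) t := by
  have hv (t : ℝ) : v x t = v x 0 + ∫ s in (0 : ℝ)..t, h x s := by
    have hu' : (fun x => u x t) = fun x => u x 0 + ∫ s in (0 : ℝ)..t, g x s := by
      ext x
      rw [intervalIntegral.integral_eq_sub_of_hasDerivAt (fun s _ => hg x s)
        ((hgc.comp (Continuous.prodMk_right x)).intervalIntegrable _ _)]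
      abel
    have h1 := (hu x 0).add (hasDerivAt_intervalIntegral_of_continuous hgc hhc
      (fun x t => hgx x t) 0 t x)
    have h2 := hu x t
    rw [hu'] at h2
    exact h2.unique h1
  rw [show (fun t => v x t) = _ from funext hv]
  exact ((hhc.comp (Continuous.prodMk_right x)).integral_hasStrictDerivAt 0
    t).hasDerivAt.const_add _

/-- The real-linear endomorphism of `ℂ × ℂ` with the given complex matrix entries. -/
@[irreducible]
noncomputable def matrixMap (a b c d : ℂ) : ℂ × ℂ →L[ℝ] ℂ × ℂ :=
  a • (ContinuousLinearMap.inl ℝ ℂ ℂ).comp (.fst ℝ ℂ ℂ) +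
    b • (ContinuousLinearMap.inl ℝ ℂ ℂ).comp (.snd ℝ ℂ ℂ) +
    c • (ContinuousLinearMap.inr ℝ ℂ ℂ).comp (.fst ℝ ℂ ℂ) +
    d • (ContinuousLinearMap.inr ℝ ℂ ℂ).comp (.snd ℝ ℂ ℂ)

lemma matrixMap_apply (a b c d : ℂ) (z : ℂ × ℂ) :
    matrixMap a b c d z = (a * z.1 + b * z.2, c * z.1 + d * z.2) := by
  refine Prod.ext ?_ ?_ <;> simp [matrixMap]

lemma Continuous.matrixMap {X : Type*} [TopologicalSpace X] {a b c d : X → ℂ}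
    (ha : Continuous a) (hb : Continuous b) (hc : Continuous c) (hd : Continuous d) :
    Continuous fun x => matrixMap (a x) (b x) (c x) (d x) := by
  unfold _root_.matrixMap
  fun_prop

lemma HasDerivAt.matrixMap {a b c d : ℝ → ℂ} {a' b' c' d' : ℂ} {x : ℝ}
    (ha : HasDerivAt a a' x) (hb : HasDerivAt b b' x) (hc : HasDerivAt c c' x)
    (hd : HasDerivAt d d' x) :
    HasDerivAt (fun x => matrixMap (a x) (b x) (c x) (d x)) (matrixMap a' b' c' d') x :=
  by
  unfold _root_.matrixMap
  exact (((ha.smul_const ((ContinuousLinearMap.inl ℝ ℂ ℂ).comp (.fst ℝ ℂ ℂ))).add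
    (hb.smul_const ((ContinuousLinearMap.inl ℝ ℂ ℂ).comp (.snd ℝ ℂ ℂ)))).add
    (hc.smul_const ((ContinuousLinearMap.inr ℝ ℂ ℂ).comp (.fst ℝ ℂ ℂ)))).add
    (hd.smul_const ((ContinuousLinearMap.inr ℝ ℂ ℂ).comp (.snd ℝ ℂ ℂ)))

/-- The coefficient of the first order system in `(u, u_x)` equivalent to `L_q u = λ u`. -/
@[irreducible]
noncomputable def spaceCoeff (q : ℝ → ℝ → ℝ) (lam : ℂ) (t x : ℝ) : ℂ × ℂ →L[ℝ] ℂ × ℂ :=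
  matrixMap 0 1 (q x t - lam) 0

/-- The coefficient of the time evolution of `(u, u_x)` under `u_t = P_q u` when
`L_q u = λ u`. -/
@[irreducible]
noncomputable def timeCoeff (q : ℝ → ℝ → ℝ) (lam : ℂ) (x t : ℝ) : ℂ × ℂ →L[ℝ] ℂ × ℂ :=
  matrixMap (-((pdx q x t : ℝ) : ℂ)) (2 * q x t + 4 * lam)
    ((2 * q x t + 4 * lam) * (q x t - lam) - ((pdx (pdx q) x t : ℝ) : ℂ)) ((pdx q x t : ℝ) : ℂ)

lemma contDiff_pdx {E : Type*} [NormedAddCommGroup E] [NormedSpace ℝ E] {f : ℝ → ℝ → E} {n : ℕ}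
    (hf : ∀ t, ContDiff ℝ (n + 1) fun x => f x t) (t : ℝ) : ContDiff ℝ n fun x => pdx f x t :=
  (contDiff_succ_iff_deriv.1 (hf t)).2.2

lemma hasDerivAt_pdx {E : Type*} [NormedAddCommGroup E] [NormedSpace ℝ E] {f : ℝ → ℝ → E} {n : ℕ}
    (hf : ∀ t, ContDiff ℝ (n + 1) fun x => f x t) (x t : ℝ) :
    HasDerivAt (fun x => f x t) (pdx f x t) x :=
  ((contDiff_succ_iff_deriv.1 (hf t)).1 x).hasDerivAt

lemma hasDerivAt_pdt {E : Type*} [NormedAddCommGroup E] [NormedSpace ℝ E] {f : ℝ → ℝ → E}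
    (hf : ∀ x, ContDiff ℝ 1 fun t => f x t) (x t : ℝ) :
    HasDerivAt (fun t => f x t) (pdt f x t) t :=
  (((hf x).differentiable one_ne_zero) t).hasDerivAt

variable {q : ℝ → ℝ → ℝ} {lam : ℂ}

lemma continuous_spaceCoeff (hqc : Continuous fun z : ℝ × ℝ => q z.1 z.2) :
    Continuous fun z : (ℂ × ℝ) × ℝ => spaceCoeff q z.1.1 z.1.2 z.2 := by
  unfold spaceCoeff
  exact Continuous.matrixMap continuous_const continuous_const (by fun_prop) continuous_const

lemma continuous_timeCoeff (hqc : Continuous fun z : ℝ × ℝ => q z.1 z.2)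
    (hqc1 : Continuous fun z : ℝ × ℝ => pdx q z.1 z.2)
    (hqc2 : Continuous fun z : ℝ × ℝ => pdx (pdx q) z.1 z.2) :
    Continuous fun z : ℂ × ℝ × ℝ => timeCoeff q z.1 z.2.1 z.2.2 := by
  unfold timeCoeff
  exact Continuous.matrixMap (by fun_prop) (by fun_prop) (by fun_prop) (by fun_prop)

lemma hasDerivAt_spaceCoeff (hqt : ∀ x t, HasDerivAt (fun t => q x t) (pdt q x t) t) (t x : ℝ) :
    HasDerivAt (fun t => spaceCoeff q lam t x) (matrixMap 0 0 ((pdt q x t : ℝ) : ℂ) 0) t := by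
  unfold spaceCoeff
  exact HasDerivAt.matrixMap (hasDerivAt_const _ _) (hasDerivAt_const _ _)
    ((hqt x t).ofReal_comp.sub_const lam) (hasDerivAt_const _ _)

/-- For solutions of `L_q u = λ u` the third derivative in `P_q u` can be eliminated. -/
lemma Pop_eq {u v : ℝ → ℝ → ℂ}
    (hqx : ∀ x t, HasDerivAt (fun x => q x t) (pdx q x t) x)
    (hu : ∀ x t, HasDerivAt (fun x => u x t) (v x t) x)
    (hv : ∀ x t, HasDerivAt (fun x => v x t) ((q x t - lam) * u x t) x) (x t : ℝ) :
    Pop q u x t = -pdx q x t * u x t + (2 * q x t + 4 * lam) * v x t := by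
  have h1 : pdx u = v := funext₂ fun x t => (hu x t).deriv
  have h2 : pdx v = fun x t => (q x t - lam) * u x t := funext₂ fun x t => (hv x t).deriv
  have h3 : pdx (fun x t => (q x t - lam) * u x t) x t =
      pdx q x t * u x t + (q x t - lam) * v x t :=
    (((hqx x t).ofReal_comp.sub_const lam).mul (hu x t)).deriv
  rw [Pop, h1, h2, h3]
  ring

lemma smoothSol_of_hasDerivAt {u v : ℝ → ℝ → ℂ}
    (hqx : ∀ x t, HasDerivAt (fun x => q x t) (pdx q x t) x)
    (hqc : Continuous fun z : ℝ × ℝ => q z.1 z.2)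
    (hqc1 : Continuous fun z : ℝ × ℝ => pdx q z.1 z.2)
    (huc : Continuous fun z : ℝ × ℝ => u z.1 z.2) (hvc : Continuous fun z : ℝ × ℝ => v z.1 z.2)
    (hu : ∀ x t, HasDerivAt (fun x => u x t) (v x t) x)
    (hv : ∀ x t, HasDerivAt (fun x => v x t) ((q x t - lam) * u x t) x)
    (hut : ∀ x t, HasDerivAt (fun t => u x t)
      (-pdx q x t * u x t + (2 * q x t + 4 * lam) * v x t) t) :
    SmoothSol q lam u := by
  have h1 : pdx u = v := funext₂ fun x t => (hu x t).deriv
  have h2 : pdx v = fun x t => (q x t - lam) * u x t := funext₂ fun x t => (hv x t).deriv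
  have h3 : pdt u = fun x t => -pdx q x t * u x t + (2 * q x t + 4 * lam) * v x t :=
    funext₂ fun x t => (hut x t).deriv
  have hvxc : Continuous fun z : ℝ × ℝ => (q z.1 z.2 - lam) * u z.1 z.2 := by fun_prop
  have hutc : Continuous fun z : ℝ × ℝ =>
      -pdx q z.1 z.2 * u z.1 z.2 + (2 * q z.1 z.2 + 4 * lam) * v z.1 z.2 := by fun_prop
  refine ⟨fun t => ?_, fun x => ?_, huc, h1 ▸ hvc, ?_, ?_, fun x t => ?_, fun x t => ?_⟩
  · have hu' : deriv (fun x => u x t) = fun x => v x t := funext fun x => (hu x t).deriv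
    have hv' : deriv (fun x => v x t) = fun x => (q x t - lam) * u x t :=
      funext fun x => (hv x t).deriv
    rw [show (2 : WithTop ℕ∞) = 1 + 1 from one_add_one_eq_two.symm, contDiff_succ_iff_deriv, hu',
      contDiff_one_iff_deriv, hv']
    exact ⟨fun x => (hu x t).differentiableAt, by simp, fun x => (hv x t).differentiableAt,
      hvxc.comp (Continuous.prodMk_left t)⟩
  · rw [contDiff_one_iff_deriv]
    refine ⟨fun t => (hut x t).differentiableAt, ?_⟩
    rw [show deriv (fun t => u x t) = _ from funext fun t => (hut x t).deriv]
    exact hutc.comp (Continuous.prodMk_right x)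
  · rw [h1, h2]
    exact hvxc
  · rw [h3]
    exact hutc
  · rw [Lop, h1, h2]
    ring
  · rw [Pop_eq hqx hu hv, h3]

namespace SmoothSol

variable {u : ℝ → ℝ → ℂ}

lemma hasDerivAt_x (hu : SmoothSol q lam u) (x t : ℝ) :
    HasDerivAt (fun x => u x t) (pdx u x t) x :=
  hasDerivAt_pdx (n := 1) (by simpa [one_add_one_eq_two] using hu.1) x t

lemma hasDerivAt_pdx_x (hu : SmoothSol q lam u) (x t : ℝ) :
    HasDerivAt (fun x => pdx u x t) ((q x t - lam) * u x t) x := by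
  have h := hasDerivAt_pdx (n := 0) (f := pdx u)
    (contDiff_pdx (n := 1) (by simpa [one_add_one_eq_two] using hu.1)) x t
  have heq : pdx (pdx u) x t = (q x t - lam) * u x t := by
    have := hu.2.2.2.2.2.2.1 x t
    rw [Lop] at this
    linear_combination -this
  rwa [heq] at h

lemma hasDerivAt_t (hqx : ∀ x t, HasDerivAt (fun x => q x t) (pdx q x t) x)
    (hu : SmoothSol q lam u) (x t : ℝ) :
    HasDerivAt (fun t => u x t)
      (-pdx q x t * u x t + (2 * q x t + 4 * lam) * pdx u x t) t := by
  rw [← Pop_eq hqx hu.hasDerivAt_x hu.hasDerivAt_pdx_x, ← hu.2.2.2.2.2.2.2 x t]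
  exact hasDerivAt_pdt hu.2.1 x t

lemma hasDerivAt_pdx_t (hqx : ∀ x t, HasDerivAt (fun x => q x t) (pdx q x t) x)
    (hqxx : ∀ x t, HasDerivAt (fun x => pdx q x t) (pdx (pdx q) x t) x)
    (hqc : Continuous fun z : ℝ × ℝ => q z.1 z.2)
    (hqc1 : Continuous fun z : ℝ × ℝ => pdx q z.1 z.2)
    (hqc2 : Continuous fun z : ℝ × ℝ => pdx (pdx q) z.1 z.2)
    (hu : SmoothSol q lam u) (x t : ℝ) :
    HasDerivAt (fun t => pdx u x t)
      (((2 * q x t + 4 * lam) * (q x t - lam) - pdx (pdx q) x t) * u x t +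
        pdx q x t * pdx u x t) t := by
  have huc := hu.2.2.1
  have hvc := hu.2.2.2.1
  refine hasDerivAt_mixed (g := fun x t =>
      -pdx q x t * u x t + (2 * q x t + 4 * lam) * pdx u x t)
    (h := fun x t => ((2 * q x t + 4 * lam) * (q x t - lam) - pdx (pdx q) x t) * u x t +
      pdx q x t * pdx u x t)
    hu.hasDerivAt_x (hu.hasDerivAt_t hqx) (by fun_prop) (fun x t => ?_) (by fun_prop) x t
  refine (((hqxx x t).ofReal_comp.fun_neg.mul (hu.hasDerivAt_x x t)).add
    ((((hqx x t).ofReal_comp.const_mul 2).add_const (4 * lam)).mul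
      (hu.hasDerivAt_pdx_x x t))).congr_deriv ?_
  ring

lemma eq_of_initial (hqx : ∀ x t, HasDerivAt (fun x => q x t) (pdx q x t) x)
    (hqxx : ∀ x t, HasDerivAt (fun x => pdx q x t) (pdx (pdx q) x t) x)
    (hqc : Continuous fun z : ℝ × ℝ => q z.1 z.2)
    (hqc1 : Continuous fun z : ℝ × ℝ => pdx q z.1 z.2)
    (hqc2 : Continuous fun z : ℝ × ℝ => pdx (pdx q) z.1 z.2) {u' : ℝ → ℝ → ℂ}
    (hu : SmoothSol q lam u) (hu' : SmoothSol q lam u')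
    (h0 : u 0 0 = u' 0 0) (h1 : pdx u 0 0 = pdx u' 0 0) : u = u' := by
  have ht {u : ℝ → ℝ → ℂ} (hu : SmoothSol q lam u) (t : ℝ) :
      HasDerivAt (fun t => (u 0 t, pdx u 0 t)) (timeCoeff q lam 0 t (u 0 t, pdx u 0 t)) t := by
    rw [timeCoeff, matrixMap_apply]
    exact (hu.hasDerivAt_t hqx 0 t).prodMk (hu.hasDerivAt_pdx_t hqx hqxx hqc hqc1 hqc2 0 t)
  have hx {u : ℝ → ℝ → ℂ} (hu : SmoothSol q lam u) (t x : ℝ) :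
      HasDerivAt (fun x => (u x t, pdx u x t)) (spaceCoeff q lam t x (u x t, pdx u x t)) x := by
    rw [spaceCoeff, matrixMap_apply]
    simpa using (hu.hasDerivAt_x x t).prodMk (hu.hasDerivAt_pdx_x x t)
  have hB : Continuous fun t => timeCoeff q lam 0 t :=
    (continuous_timeCoeff hqc hqc1 hqc2).comp
      (continuous_const.prodMk (continuous_const.prodMk continuous_id))
  have hA (t : ℝ) : Continuous fun x => spaceCoeff q lam t x :=
    (continuous_spaceCoeff hqc).comp (Continuous.prodMk_right (lam, t))
  have hzero := eq_of_hasDerivAt_linear hB (ht hu) (ht hu') (by simp only [h0, h1])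
  ext x t
  have hxt := eq_of_hasDerivAt_linear (hA t) (hx hu t) (hx hu' t) (congrFun hzero t)
  exact congrArg Prod.fst (congrFun hxt x)

end SmoothSol

/-- The `x`-derivative of `timeCoeff`. -/
noncomputable def timeCoeffDeriv (q : ℝ → ℝ → ℝ) (lam : ℂ) (x t : ℝ) : ℂ × ℂ →L[ℝ] ℂ × ℂ :=
  matrixMap (-((pdx (pdx q) x t : ℝ) : ℂ)) (2 * ((pdx q x t : ℝ) : ℂ))
    (2 * ((pdx q x t : ℝ) : ℂ) * (q x t - lam) + (2 * q x t + 4 * lam) * ((pdx q x t : ℝ) : ℂ) -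
      ((pdx (pdx (pdx q)) x t : ℝ) : ℂ)) ((pdx (pdx q) x t : ℝ) : ℂ)

lemma hasDerivAt_timeCoeff (hqx : ∀ x t, HasDerivAt (fun x => q x t) (pdx q x t) x)
    (hqxx : ∀ x t, HasDerivAt (fun x => pdx q x t) (pdx (pdx q) x t) x)
    (hqxxx : ∀ x t, HasDerivAt (fun x => pdx (pdx q) x t) (pdx (pdx (pdx q)) x t) x) (x t : ℝ) :
    HasDerivAt (fun x => timeCoeff q lam x t) (timeCoeffDeriv q lam x t) x := by
  unfold timeCoeff
  have hb := ((hqx x t).ofReal_comp.const_mul 2).add_const (4 * lam)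
  exact HasDerivAt.matrixMap (hqxx x t).ofReal_comp.fun_neg hb
    ((hb.mul ((hqx x t).ofReal_comp.sub_const lam)).sub (hqxxx x t).ofReal_comp)
    (hqxx x t).ofReal_comp

/-- The zero curvature form of the KdV equation. -/
lemma KdV.zero_curvature (hkdv : KdV q) (x t : ℝ) (z : ℂ × ℂ) :
    matrixMap 0 0 ((pdt q x t : ℝ) : ℂ) 0 z + spaceCoeff q lam t x (timeCoeff q lam x t z) =
      timeCoeffDeriv q lam x t z +
      timeCoeff q lam x t (spaceCoeff q lam t x z) := by
  simp only [spaceCoeff, timeCoeff, timeCoeffDeriv, matrixMap_apply, hkdv x t]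
  push_cast
  ext <;> simp only [Prod.fst_add, Prod.snd_add] <;> ring

/-- The joint solution of the Lax system, as a function of `λ`. -/
lemma KdV.exists_smoothSol_family (hkdv : KdV q)
    (hqx : ∀ x t, HasDerivAt (fun x => q x t) (pdx q x t) x)
    (hqxx : ∀ x t, HasDerivAt (fun x => pdx q x t) (pdx (pdx q) x t) x)
    (hqxxx : ∀ x t, HasDerivAt (fun x => pdx (pdx q) x t) (pdx (pdx (pdx q)) x t) x)
    (hqt : ∀ x t, HasDerivAt (fun t => q x t) (pdt q x t) t)
    (hqc : Continuous fun z : ℝ × ℝ => q z.1 z.2)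
    (hqc1 : Continuous fun z : ℝ × ℝ => pdx q z.1 z.2)
    (hqc2 : Continuous fun z : ℝ × ℝ => pdx (pdx q) z.1 z.2)
    (hqct : Continuous fun z : ℝ × ℝ => pdt q z.1 z.2)
    {a b : ℂ → ℂ} (ha : Continuous a) (hb : Continuous b) :
    ∃ U : ℂ → ℝ → ℝ → ℂ,
      (∀ lam, SmoothSol q lam (U lam) ∧ U lam 0 0 = a lam ∧ pdx (U lam) 0 0 = b lam) ∧
      Continuous fun p : ℂ × ℝ × ℝ => U p.1 p.2.1 p.2.2 := by
  have hA := continuous_spaceCoeff hqc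
  have hA' : Continuous fun z : (ℂ × ℝ) × ℝ => matrixMap 0 0 ((pdt q z.2 z.1.2 : ℝ) : ℂ) 0 :=
    Continuous.matrixMap continuous_const continuous_const (by fun_prop) continuous_const
  have hB0 : Continuous fun z : ℂ × ℝ => timeCoeff q z.1 0 z.2 :=
    (continuous_timeCoeff hqc hqc1 hqc2).comp
      (continuous_fst.prodMk (continuous_const.prodMk continuous_snd))
  have hw : Continuous fun z : ℂ × ℝ => linearFlow (timeCoeff q z.1 0) (a z.1, b z.1) z.2 :=
    have hab : Continuous fun lam => (a lam, b lam) := ha.prodMk hb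
    continuous_linearFlow (A := fun lam => timeCoeff q lam 0) (w := fun lam => (a lam, b lam))
      hB0 hab
  obtain ⟨W, Z, hWc, hWx, hZx, hWt, hW0, hZ0⟩ := exists_linear_family
    (A := fun lam t x => spaceCoeff q lam t x)
    (A' := fun _ t x => matrixMap 0 0 ((pdt q x t : ℝ) : ℂ) 0)
    (w := fun lam => linearFlow (timeCoeff q lam 0) (a lam, b lam))
    (w' := fun lam t => timeCoeff q lam 0 t (linearFlow (timeCoeff q lam 0) (a lam, b lam) t))
    hA hA'
    (fun lam t x => hasDerivAt_spaceCoeff hqt t x)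
    hw (hB0.clm_apply hw)
    (fun lam t => hasDerivAt_linearFlow (hB0.comp (Continuous.prodMk_right lam)) _ t)
  have hZ (lam : ℂ) (x t : ℝ) : Z lam x t = timeCoeff q lam x t (W lam x t) := by
    have hdiff : (fun x => Z lam x t - timeCoeff q lam x t (W lam x t)) = fun _ => 0 := by
      refine eq_of_hasDerivAt_linear (A := fun x => spaceCoeff q lam t x)
        (hA.comp (Continuous.prodMk_right (lam, t))) (fun x => ?_) (fun x => ?_) ?_
      · have hB := hasDerivAt_timeCoeff (lam := lam) hqx hqxx hqxxx x t
        refine ((hZx lam x t).sub (hB.clm_apply (hWx lam x t))).congr_deriv ?_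
        simp only [map_sub]
        rw [add_sub_right_comm, eq_sub_of_add_eq (hkdv.zero_curvature (lam := lam) x t (W lam x t))]
        abel
      · simpa using hasDerivAt_const x (0 : ℂ × ℂ)
      · simp [hW0, hZ0]
    exact sub_eq_zero.1 (congrFun hdiff x)
  refine ⟨fun lam x t => (W lam x t).1, fun lam => ?_, hWc.fst⟩
  have hux (x t : ℝ) : HasDerivAt (fun x => (W lam x t).1) (W lam x t).2 x := by
    have h : HasDerivAt (fun x => (W lam x t).1) _ x := (hWx lam x t).fst
    simpa [spaceCoeff, matrixMap_apply] using h
  have hWlam : Continuous fun z : ℝ × ℝ => W lam z.1 z.2 :=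
    hWc.comp (Continuous.prodMk_right lam)
  refine ⟨smoothSol_of_hasDerivAt hqx hqc hqc1 (v := fun x t => (W lam x t).2)
    hWlam.fst hWlam.snd hux (fun x t => ?_) (fun x t => ?_), ?_, ?_⟩
  · have h : HasDerivAt (fun x => (W lam x t).2) _ x := (hWx lam x t).snd
    simpa [spaceCoeff, matrixMap_apply] using h
  · have h : HasDerivAt (fun t => (W lam x t).1) _ t := (hWt lam x t).fst
    rwa [hZ, timeCoeff, matrixMap_apply] at h
  · simp [hW0, linearFlow_zero]
  · change deriv (fun x => (W lam x 0).1) 0 = b lam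
    rw [(hux 0 0).deriv]
    simp [hW0, linearFlow_zero]

end LaxPair

theorem statement5 (q : ℝ → ℝ → ℝ)
    (hqx : ∀ t, ContDiff ℝ 3 fun x => q x t)
    (hqt : ∀ x, ContDiff ℝ 1 fun t => q x t)
    (hqc : Continuous (fun p : ℝ × ℝ => q p.1 p.2))
    (hqc1 : Continuous (fun p : ℝ × ℝ => pdx q p.1 p.2))
    (hqc2 : Continuous (fun p : ℝ × ℝ => pdx (pdx q) p.1 p.2))
    (hqc3 : Continuous (fun p : ℝ × ℝ => pdx (pdx (pdx q)) p.1 p.2))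
    (hqct : Continuous (fun p : ℝ × ℝ => pdt q p.1 p.2))
    (hkdv : KdV q)
    (hbound : ∀ t, ∃ C, ∀ x, |q x t| ≤ C ∧ |pdx q x t| ≤ C) :
    (∀ (lam a₀ b₀ : ℂ), ∃! u : ℝ → ℝ → ℂ,
        SmoothSol q lam u ∧ u 0 0 = a₀ ∧ pdx u 0 0 = b₀) ∧
    (∀ a₀ b₀ : ℂ → ℂ, Continuous a₀ → Continuous b₀ →
      ∃ U : ℂ → ℝ → ℝ → ℂ,
        (∀ lam, SmoothSol q lam (U lam) ∧ U lam 0 0 = a₀ lam ∧ pdx (U lam) 0 0 = b₀ lam) ∧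
        Continuous fun p : ℂ × ℝ × ℝ => U p.1 p.2.1 p.2.2) := by
  have h1 := hasDerivAt_pdx (n := 2) (f := q) hqx
  have hqx1 := contDiff_pdx (n := 2) (f := q) hqx
  have h2 := hasDerivAt_pdx (n := 1) hqx1
  have h3 := hasDerivAt_pdx (n := 0) (contDiff_pdx (n := 1) hqx1)
  have hfamily {a b : ℂ → ℂ} (ha : Continuous a) (hb : Continuous b) :=
    hkdv.exists_smoothSol_family h1 h2 h3 (hasDerivAt_pdt hqt) hqc hqc1 hqc2 hqct ha hb
  refine ⟨fun lam a₀ b₀ => ?_, fun a₀ b₀ ha hb => hfamily ha hb⟩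
  obtain ⟨U, hU, -⟩ := hfamily (continuous_const (y := a₀)) (continuous_const (y := b₀))
  refine ⟨U lam, hU lam, fun u hu => ?_⟩
  exact hu.1.eq_of_initial h1 h2 hqc hqc1 hqc2 (hU lam).1 (hu.2.1.trans (hU lam).2.1.symm)
    (hu.2.2.trans (hU lam).2.2.symm)
end

section
/- Let q : ℝ×ℝ → ℝ be sufficiently smooth, λ ∈ ℂ, and let u₁, u₂ : ℝ×ℝ → ℂ both satisfy the system L_q u = λ u and u_t = P_q u (with continuous mixed partial derivatives). Then the Wronskian W(u₁,u₂)(x,t) = u₁(x,t) ∂_x u₂(x,t) - ∂_x u₁(x,t) · u₂(x,t) depends neither on x nor on t. -/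
section PartialDerivatives

variable {E : Type*} [NormedAddCommGroup E] [NormedSpace ℝ E] {u : ℝ → ℝ → E}

theorem hasDerivAt_fst_of_differentiable (hu : Differentiable ℝ fun p : ℝ × ℝ => u p.1 p.2)
    (x t : ℝ) :
    HasDerivAt (fun y => u y t) (fderiv ℝ (fun p : ℝ × ℝ => u p.1 p.2) (x, t) (1, 0)) x :=
  (hu (x, t)).hasFDerivAt.comp_hasDerivAt (f := fun y : ℝ => (y, t)) x
    ((hasDerivAt_id x).prodMk (hasDerivAt_const x t))

theorem hasDerivAt_snd_of_differentiable (hu : Differentiable ℝ fun p : ℝ × ℝ => u p.1 p.2)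
    (x t : ℝ) :
    HasDerivAt (fun s => u x s) (fderiv ℝ (fun p : ℝ × ℝ => u p.1 p.2) (x, t) (0, 1)) t :=
  (hu (x, t)).hasFDerivAt.comp_hasDerivAt (f := fun s : ℝ => (x, s)) t
    ((hasDerivAt_const t x).prodMk (hasDerivAt_id t))

theorem hasDerivAt_pdx_s6 (hu : Differentiable ℝ fun p : ℝ × ℝ => u p.1 p.2) (x t : ℝ) :
    HasDerivAt (fun y => u y t) (pdx u x t) x :=
  (hasDerivAt_fst_of_differentiable hu x t).differentiableAt.hasDerivAt

theorem hasDerivAt_pdt_s6 (hu : Differentiable ℝ fun p : ℝ × ℝ => u p.1 p.2) (x t : ℝ) :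
    HasDerivAt (fun s => u x s) (pdt u x t) t :=
  (hasDerivAt_snd_of_differentiable hu x t).differentiableAt.hasDerivAt

theorem pdx_eq_fderiv (hu : Differentiable ℝ fun p : ℝ × ℝ => u p.1 p.2) :
    pdx u = fun x t => fderiv ℝ (fun p : ℝ × ℝ => u p.1 p.2) (x, t) (1, 0) :=
  funext₂ fun x t => (hasDerivAt_fst_of_differentiable hu x t).deriv

theorem pdt_eq_fderiv (hu : Differentiable ℝ fun p : ℝ × ℝ => u p.1 p.2) :
    pdt u = fun x t => fderiv ℝ (fun p : ℝ × ℝ => u p.1 p.2) (x, t) (0, 1) :=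
  funext₂ fun x t => (hasDerivAt_snd_of_differentiable hu x t).deriv

theorem ContDiff.pdx (hu : ContDiff ℝ (⊤ : ℕ∞) fun p : ℝ × ℝ => u p.1 p.2) :
    ContDiff ℝ (⊤ : ℕ∞) fun p : ℝ × ℝ => _root_.pdx u p.1 p.2 := by
  rw [pdx_eq_fderiv (hu.differentiable (by simp))]
  exact (hu.fderiv_right (by simp)).clm_apply contDiff_const

theorem pdt_pdx_comm (hu : ContDiff ℝ (⊤ : ℕ∞) fun p : ℝ × ℝ => u p.1 p.2) :
    pdt (pdx u) = pdx (pdt u) := by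
  have hd : Differentiable ℝ fun p : ℝ × ℝ => u p.1 p.2 := hu.differentiable (by simp)
  have hd' : Differentiable ℝ (fderiv ℝ fun p : ℝ × ℝ => u p.1 p.2) :=
    (hu.fderiv_right (m := (⊤ : ℕ∞)) (by simp)).differentiable (by simp)
  have apply_const (v p : ℝ × ℝ) :
      HasFDerivAt (fun p => fderiv ℝ (fun p : ℝ × ℝ => u p.1 p.2) p v)
        ((fderiv ℝ (fderiv ℝ fun p : ℝ × ℝ => u p.1 p.2) p).flip v) p := by
    simpa using (hd' p).hasFDerivAt.clm_apply (hasFDerivAt_const v p)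
  rw [pdx_eq_fderiv hd, pdt_eq_fderiv hd,
    pdt_eq_fderiv fun p => (apply_const (1, 0) p).differentiableAt,
    pdx_eq_fderiv fun p => (apply_const (0, 1) p).differentiableAt]
  ext x t
  have hsymm : IsSymmSndFDerivAt ℝ (fun p : ℝ × ℝ => u p.1 p.2) (x, t) :=
    hu.contDiffAt.isSymmSndFDerivAt <| by
      rw [minSmoothness_of_isRCLikeNormedField]
      exact WithTop.coe_le_coe.mpr (le_top : (2 : ℕ∞) ≤ ⊤)
  rw [(apply_const (1, 0) (x, t)).fderiv, (apply_const (0, 1) (x, t)).fderiv]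
  exact hsymm.eq _ _

end PartialDerivatives

section LaxPair

variable {q : ℝ → ℝ → ℝ} {lam : ℂ} {u : ℝ → ℝ → ℂ}

theorem pdx_pdx_of_Lop_eq (heq : ∀ x t, Lop q u x t = lam * u x t) :
    pdx (pdx u) = fun x t => ((q x t : ℂ) - lam) * u x t := by
  ext x t
  have h := heq x t
  simp only [Lop] at h
  linear_combination -h

/-- On the eigenspace of `L_q`, the flow `u_t = P_q u` is a first-order equation. -/
theorem pdt_of_lax (hq : ContDiff ℝ (⊤ : ℕ∞) fun p : ℝ × ℝ => q p.1 p.2)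
    (hu : ContDiff ℝ (⊤ : ℕ∞) fun p : ℝ × ℝ => u p.1 p.2)
    (heq : ∀ x t, Lop q u x t = lam * u x t) (ht : ∀ x t, pdt u x t = Pop q u x t) :
    pdt u = fun x t =>
      (2 * (q x t : ℂ) + 4 * lam) * pdx u x t - ((pdx q x t : ℝ) : ℂ) * u x t := by
  ext x t
  have hqx := (hasDerivAt_pdx_s6 (hq.differentiable (by simp)) x t).ofReal_comp
  have hux := hasDerivAt_pdx_s6 (hu.differentiable (by simp)) x t
  have huxxx : pdx (pdx (pdx u)) x t =
      ((pdx q x t : ℝ) : ℂ) * u x t + ((q x t : ℂ) - lam) * pdx u x t := by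
    rw [pdx_pdx_of_Lop_eq heq]
    exact ((hqx.sub_const lam).mul hux).deriv
  rw [ht, Pop, huxxx]
  ring

theorem pdt_pdx_of_lax (hq : ContDiff ℝ (⊤ : ℕ∞) fun p : ℝ × ℝ => q p.1 p.2)
    (hu : ContDiff ℝ (⊤ : ℕ∞) fun p : ℝ × ℝ => u p.1 p.2)
    (heq : ∀ x t, Lop q u x t = lam * u x t) (ht : ∀ x t, pdt u x t = Pop q u x t) (x t : ℝ) :
    pdt (pdx u) x t = ((pdx q x t : ℝ) : ℂ) * pdx u x t
      + ((2 * (q x t : ℂ) + 4 * lam) * ((q x t : ℂ) - lam)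
        - ((pdx (pdx q) x t : ℝ) : ℂ)) * u x t := by
  have hqx := (hasDerivAt_pdx_s6 (hq.differentiable (by simp)) x t).ofReal_comp
  have hqxx := (hasDerivAt_pdx_s6 (hq.pdx.differentiable (by simp)) x t).ofReal_comp
  have hux := hasDerivAt_pdx_s6 (hu.differentiable (by simp)) x t
  have huxx := hasDerivAt_pdx_s6 (hu.pdx.differentiable (by simp)) x t
  have hutx : pdx (pdt u) x t =
      2 * ((pdx q x t : ℝ) : ℂ) * pdx u x t + (2 * (q x t : ℂ) + 4 * lam) * pdx (pdx u) x t
        - (((pdx (pdx q) x t : ℝ) : ℂ) * u x t + ((pdx q x t : ℝ) : ℂ) * pdx u x t) := by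
    rw [pdt_of_lax hq hu heq ht]
    exact ((((hqx.const_mul 2).add_const (4 * lam)).mul huxx).sub (hqxx.mul hux)).deriv
  rw [pdt_pdx_comm hu, hutx, pdx_pdx_of_Lop_eq heq]
  ring

end LaxPair

theorem statement6 (q : ℝ → ℝ → ℝ) (lam : ℂ) (u₁ u₂ : ℝ → ℝ → ℂ)
    (hq : ContDiff ℝ (⊤ : ℕ∞) fun p : ℝ × ℝ => q p.1 p.2)
    (hu₁ : ContDiff ℝ (⊤ : ℕ∞) fun p : ℝ × ℝ => u₁ p.1 p.2)
    (hu₂ : ContDiff ℝ (⊤ : ℕ∞) fun p : ℝ × ℝ => u₂ p.1 p.2)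
    (heq₁ : ∀ x t, Lop q u₁ x t = lam * u₁ x t)
    (heq₂ : ∀ x t, Lop q u₂ x t = lam * u₂ x t)
    (ht₁ : ∀ x t, pdt u₁ x t = Pop q u₁ x t)
    (ht₂ : ∀ x t, pdt u₂ x t = Pop q u₂ x t) :
    ∀ x t x' t',
      u₁ x t * pdx u₂ x t - pdx u₁ x t * u₂ x t
        = u₁ x' t' * pdx u₂ x' t' - pdx u₁ x' t' * u₂ x' t' := by
  have hx (t x : ℝ) :
      HasDerivAt (fun y => u₁ y t * pdx u₂ y t - pdx u₁ y t * u₂ y t) 0 x := by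
    have h₁ := hasDerivAt_pdx_s6 (hu₁.differentiable (by simp)) x t
    have h₂ := hasDerivAt_pdx_s6 (hu₂.differentiable (by simp)) x t
    have h₁x := hasDerivAt_pdx_s6 (hu₁.pdx.differentiable (by simp)) x t
    have h₂x := hasDerivAt_pdx_s6 (hu₂.pdx.differentiable (by simp)) x t
    refine ((h₁.mul h₂x).sub (h₁x.mul h₂)).congr_deriv ?_
    rw [pdx_pdx_of_Lop_eq heq₁, pdx_pdx_of_Lop_eq heq₂]
    ring
  have ht (x t : ℝ) :
      HasDerivAt (fun s => u₁ x s * pdx u₂ x s - pdx u₁ x s * u₂ x s) 0 t := by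
    have h₁ := hasDerivAt_pdt_s6 (hu₁.differentiable (by simp)) x t
    have h₂ := hasDerivAt_pdt_s6 (hu₂.differentiable (by simp)) x t
    have h₁x := hasDerivAt_pdt_s6 (hu₁.pdx.differentiable (by simp)) x t
    have h₂x := hasDerivAt_pdt_s6 (hu₂.pdx.differentiable (by simp)) x t
    refine ((h₁.mul h₂x).sub (h₁x.mul h₂)).congr_deriv ?_
    rw [pdt_pdx_of_lax hq hu₁ heq₁ ht₁, pdt_pdx_of_lax hq hu₂ heq₂ ht₂,
      pdt_of_lax hq hu₁ heq₁ ht₁, pdt_of_lax hq hu₂ heq₂ ht₂]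
    ring
  intro x t x' t'
  exact (is_const_of_deriv_eq_zero (fun y => (hx t y).differentiableAt)
      (fun y => (hx t y).deriv) x x').trans
    (is_const_of_deriv_eq_zero (fun s => (ht x' s).differentiableAt)
      (fun s => (ht x' s).deriv) t t')
end
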